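/- Every Coxeter HNN-extension C(S,m,φ) contains a finite-index subgroup that embeds into a Coxeter group whose set of labels is contained in L(S,m) ∪ {2, ∞}. -/

import Mathlib

/-- The Coxeter relations of the system (α, m): s² = 1 for every generator, and
(st)^{m(s,t)} = 1 for each pair s ≠ t with m(s,t) = n < ∞. -/
def coxRels {α : Type*} (m : α → α → ℕ∞) : Set (FreeGroup α) :=
  {r | (∃ s : α, r = FreeGroup.of s * FreeGroup.of s) ∨
       (∃ (s t : α) (n : ℕ), s ≠ t ∧ m s t = (n : ℕ∞) ∧
          r = (FreeGroup.of s * FreeGroup.of t) ^ n)}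

/-- The Coxeter group W(α, m), as a presented group. -/
def CoxGroup {α : Type*} (m : α → α → ℕ∞) : Type _ := PresentedGroup (coxRels m)

instance {α : Type*} (m : α → α → ℕ∞) : Group (CoxGroup m) :=
  inferInstanceAs (Group (PresentedGroup _))

/-- The relations of the Coxeter HNN-extension C(α, m, φ): generators α together with a
stable letter t (of infinite order, no relation imposed on it alone); the Coxeter
relations of (α, m), together with t⁻¹ s t = φ(s) for s ∈ S'. -/
def coxHNNRels {α : Type*} (m : α → α → ℕ∞) (S' : Set α) (φ : α → α) :
    Set (FreeGroup (α ⊕ Unit)) :=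
  {r | (∃ s : α, r = FreeGroup.of (Sum.inl s) * FreeGroup.of (Sum.inl s)) ∨
       (∃ (s t : α) (n : ℕ), s ≠ t ∧ m s t = (n : ℕ∞) ∧
          r = (FreeGroup.of (Sum.inl s) * FreeGroup.of (Sum.inl t)) ^ n) ∨
       (∃ s ∈ S', r = (FreeGroup.of (Sum.inr ()))⁻¹ * FreeGroup.of (Sum.inl s) *
          FreeGroup.of (Sum.inr ()) * (FreeGroup.of (Sum.inl (φ s)))⁻¹)}

/-- The Coxeter HNN-extension C(α, m, φ). -/
def CoxHNN {α : Type*} (m : α → α → ℕ∞) (S' : Set α) (φ : α → α) : Type _ :=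
  PresentedGroup (coxHNNRels m S' φ)

instance {α : Type*} (m : α → α → ℕ∞) (S' : Set α) (φ : α → α) :
    Group (CoxHNN m S' φ) := inferInstanceAs (Group (PresentedGroup _))


section CoxBasics
variable {α : Type} {m : α → α → ℕ∞}

/-- The generators of the Coxeter group. -/
def coxOf (m : α → α → ℕ∞) (s : α) : CoxGroup m := PresentedGroup.of (rels := coxRels m) s

theorem coxOf_sq (s : α) : coxOf m s * coxOf m s = 1 :=
  PresentedGroup.one_of_mem (rels := coxRels m) (Or.inl ⟨s, rfl⟩)

theorem coxOf_inv (s : α) : (coxOf m s)⁻¹ = coxOf m s :=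
  inv_eq_of_mul_eq_one_left (coxOf_sq s)

theorem coxOf_rel {s t : α} {n : ℕ} (hst : s ≠ t) (h : m s t = n) :
    (coxOf m s * coxOf m t) ^ n = 1 :=
  PresentedGroup.one_of_mem (rels := coxRels m) (Or.inr ⟨s, t, n, hst, h, rfl⟩)

/-- Universal property of the Coxeter group. -/
def coxLift {G : Type*} [Group G] (f : α → G) (h1 : ∀ s, f s * f s = 1)
    (h2 : ∀ (s t : α) (n : ℕ), s ≠ t → m s t = n → (f s * f t) ^ n = 1) : CoxGroup m →* G :=
  PresentedGroup.toGroup (rels := coxRels m) (f := f) (by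
    rintro r (⟨s, rfl⟩ | ⟨s, t, n, hst, h, rfl⟩)
    · simpa using h1 s
    · simpa using h2 s t n hst h)

@[simp] theorem coxLift_of {G : Type*} [Group G] (f : α → G) (h1 : ∀ s, f s * f s = 1)
    (h2 : ∀ (s t : α) (n : ℕ), s ≠ t → m s t = n → (f s * f t) ^ n = 1) (s : α) :
    coxLift (m := m) f h1 h2 (coxOf m s) = f s :=
  PresentedGroup.toGroup.of _

theorem coxHom_ext {G : Type*} [Group G] {f g : CoxGroup m →* G}
    (h : ∀ s, f (coxOf m s) = g (coxOf m s)) : f = g :=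
  PresentedGroup.ext (rels := coxRels m) h

/-- The element represented by a word. -/
def coxWord (m : α → α → ℕ∞) (x : List α) : CoxGroup m := (x.map (coxOf m)).prod

@[simp] theorem coxWord_nil : coxWord m [] = 1 := rfl
@[simp] theorem coxWord_cons (a : α) (x : List α) :
    coxWord m (a :: x) = coxOf m a * coxWord m x := by simp [coxWord]
@[simp] theorem coxWord_append (x y : List α) :
    coxWord m (x ++ y) = coxWord m x * coxWord m y := by simp [coxWord]

theorem coxWord_reverse (x : List α) : coxWord m x.reverse = (coxWord m x)⁻¹ := by
  induction x with
  | nil => simp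
  | cons a x ih => simp [ih, coxOf_inv]

theorem coxWord_surj (w : CoxGroup m) : ∃ x, coxWord m x = w := by
  obtain ⟨w, rfl⟩ := PresentedGroup.mk_surjective (coxRels m) w
  induction w using FreeGroup.induction_on with
  | C1 => exact ⟨[], by simp; rfl⟩
  | of a => exact ⟨[a], by simp; rfl⟩
  | inv_of a ih => exact ⟨[a], by
      rw [map_inv]
      change _ = (coxOf m a)⁻¹
      simp [coxOf_inv]⟩
  | mul a b iha ihb =>
    obtain ⟨x, hx⟩ := iha
    obtain ⟨y, hy⟩ := ihb
    exact ⟨x ++ y, by rw [coxWord_append, hx, hy, map_mul]; rfl⟩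

end CoxBasics

section CoxCocycle
open Classical
variable {α : Type} {m : α → α → ℕ∞}

/-- Indicator of equality, with values in `ZMod 2`. -/
noncomputable def delta2 {G : Type} (a b : G) : ZMod 2 := if a = b then 1 else 0

/-- The elementary permutation of `W × ZMod 2`. -/
noncomputable def cocFun {G : Type} [Group G] (s : G) (p : G × ZMod 2) : G × ZMod 2 :=
  (s * p.1 * s, p.2 + delta2 p.1 s)

theorem zmod2_add_self (a : ZMod 2) : a + a = 0 := by revert a; decide

theorem cocFun_invol {G : Type} [Group G] (s : G) (hs : s * s = 1) (p : G × ZMod 2) :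
    cocFun s (cocFun s p) = p := by
  have hi : s⁻¹ = s := inv_eq_of_mul_eq_one_left hs
  obtain ⟨r, e⟩ := p
  have : delta2 (s * r * s) s = delta2 r s := by
    unfold delta2
    congr 1
    apply propext
    constructor
    · intro h
      have h' : s * r = 1 := by simpa using h
      rw [← hi]; exact (inv_eq_of_mul_eq_one_right h').symm
    · rintro rfl; simp [hs]
  simp only [cocFun, this, Prod.mk.injEq]
  constructor
  · calc s * (s * r * s) * s = (s * s) * r * (s * s) := by group
      _ = r := by simp [hs]
  · rw [add_assoc, zmod2_add_self, add_zero]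

/-- The elementary permutation of `W × ZMod 2`, as a permutation. -/
noncomputable def cocPerm {G : Type} [Group G] (s : G) (hs : s * s = 1) :
    Equiv.Perm (G × ZMod 2) :=
  ⟨cocFun s, cocFun s, cocFun_invol s hs, cocFun_invol s hs⟩

theorem cocPerm_pow {G : Type} [Group G] (s t : G) (hs : s * s = 1) (ht : t * t = 1) (k : ℕ)
    (r : G) (e : ZMod 2) :
    ((cocPerm s hs * cocPerm t ht) ^ k) (r, e) =
      ((s * t) ^ k * r * (t * s) ^ k,
        e + ∑ j ∈ Finset.range (2 * k), delta2 r ((t * s) ^ j * t)) := by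
  have hsi : s⁻¹ = s := inv_eq_of_mul_eq_one_left hs
  have hti : t⁻¹ = t := inv_eq_of_mul_eq_one_left ht
  induction k with
  | zero => simp
  | succ k ih =>
    rw [pow_succ', Equiv.Perm.mul_apply, ih]
    have hst : (s * t)⁻¹ = t * s := by rw [mul_inv_rev, hsi, hti]
    have hts : (t * s)⁻¹ = s * t := by rw [mul_inv_rev, hsi, hti]
    have hconj : t * (s * t) * t = t * s := by rw [mul_assoc, mul_assoc, ht, mul_one]
    have e1 : delta2 ((s * t) ^ k * r * (t * s) ^ k) t = delta2 r ((t * s) ^ (2 * k) * t) := by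
      unfold delta2
      congr 1
      apply propext
      have : (t * s) ^ k * t * (s * t) ^ k = (t * s) ^ (2 * k) * t := by
        have : t * (s * t) ^ k = (t * s) ^ k * t := by
          have := mul_pow_mul t s k
          rw [← this]
        rw [mul_assoc, this, ← mul_assoc, ← pow_add, two_mul]
      have h3 : (t * s) ^ k = ((s * t) ^ k)⁻¹ := by rw [← inv_pow, hst]
      rw [← this, h3]
      generalize (s * t) ^ k = c
      constructor
      · intro h; rw [← h]; group
      · intro h; rw [h]; group
    have e2 : delta2 (t * ((s * t) ^ k * r * (t * s) ^ k) * t) s =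
        delta2 r ((t * s) ^ (2 * k + 1) * t) := by
      unfold delta2
      congr 1
      apply propext
      have : (t * s) ^ k * (t * s * t) * (s * t) ^ k = (t * s) ^ (2 * k + 1) * t := by
        have : t * (s * t) ^ k = (t * s) ^ k * t := by
          have := mul_pow_mul t s k
          rw [← this]
        rw [mul_assoc, mul_assoc (t * s), this, ← mul_assoc, ← mul_assoc, ← pow_succ, ← pow_add]
        congr 2; ring
      rw [← this]
      have h3 : (t * s) ^ k = ((s * t) ^ k)⁻¹ := by rw [← inv_pow, hst]
      rw [h3]
      generalize (s * t) ^ k = c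
      constructor
      · intro h
        rw [← h]
        calc r = c⁻¹ * ((t * t) * (c * r * c⁻¹) * (t * t)) * c := by
              rw [ht]; group
          _ = _ := by group
      · intro h; rw [h]
        calc _ = (t * t) * s * (t * t) := by group
          _ = s := by simp [ht]
    change cocFun s (cocFun t _) = _
    simp only [cocFun, e1, e2, Prod.mk.injEq]
    constructor
    · rw [pow_succ', pow_succ]; simp only [mul_assoc]
    · rw [show 2 * (k + 1) = 2 * k + 1 + 1 by ring, Finset.sum_range_succ, Finset.sum_range_succ]
      ring

/-- The action of the Coxeter group on `W × ZMod 2`. -/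
noncomputable def cocHom (m : α → α → ℕ∞) : CoxGroup m →* Equiv.Perm (CoxGroup m × ZMod 2) :=
  coxLift (fun s => cocPerm (coxOf m s) (coxOf_sq s))
    (fun s => by ext1 p; exact cocFun_invol _ (coxOf_sq s) p)
    (fun s t n hst hn => by
      ext1 ⟨r, e⟩
      have h1 := coxOf_rel hst hn
      have h2 : (coxOf m t * coxOf m s) ^ n = 1 := by
        have : coxOf m t * coxOf m s = (coxOf m s * coxOf m t)⁻¹ := by
          rw [mul_inv_rev, coxOf_inv, coxOf_inv]
        rw [this, inv_pow, h1, inv_one]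
      rw [cocPerm_pow, h1, h2, two_mul, Finset.sum_range_add]
      simp only [pow_add, h2, one_mul, mul_one, zmod2_add_self, add_zero, Equiv.Perm.one_apply])

/-- The parity of the number of occurrences of the reflection `r` along a word. -/
noncomputable def cocCount (m : α → α → ℕ∞) : List α → CoxGroup m → ZMod 2
  | [], _ => 0
  | b :: y, r => delta2 r (coxOf m b) + cocCount m y (coxOf m b * r * coxOf m b)

theorem cocHom_word (y : List α) (r : CoxGroup m) (e : ZMod 2) :
    cocHom m (coxWord m y)⁻¹ (r, e) = ((coxWord m y)⁻¹ * r * coxWord m y, e + cocCount m y r) := by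
  induction y generalizing r e with
  | nil => simp [cocCount]
  | cons b y ih =>
    rw [coxWord_cons, mul_inv_rev, coxOf_inv, map_mul, Equiv.Perm.mul_apply]
    have : cocHom m (coxOf m b) (r, e) =
        (coxOf m b * r * coxOf m b, e + delta2 r (coxOf m b)) := by
      rw [cocHom, coxLift_of]; rfl
    rw [this, ih, cocCount]
    simp only [mul_assoc, add_assoc]

theorem cocCount_congr {x y : List α} (h : coxWord m x = coxWord m y) (r : CoxGroup m) :
    cocCount m x r = cocCount m y r := by
  have h1 := cocHom_word (m := m) x r 0
  have h2 := cocHom_word (m := m) y r 0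
  rw [h, h2] at h1
  simpa using (congrArg Prod.snd h1).symm

theorem exists_of_cocCount_ne {y : List α} {r : CoxGroup m} (h : cocCount m y r ≠ 0) :
    ∃ y1 b y2, y = y1 ++ b :: y2 ∧ r * coxWord m y1 = coxWord m y1 * coxOf m b := by
  induction y generalizing r with
  | nil => simp [cocCount] at h
  | cons b y ih =>
    by_cases hr : r = coxOf m b
    · exact ⟨[], b, y, rfl, by simp [hr]⟩
    · simp only [cocCount, delta2, hr, if_false, zero_add] at h
      obtain ⟨y1, c, y2, rfl, h2⟩ := ih h
      refine ⟨b :: y1, c, y2, rfl, ?_⟩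
      rw [coxWord_cons, mul_assoc (coxOf m b), ← h2]
      simp only [← mul_assoc]
      rw [coxOf_sq, one_mul]

end CoxCocycle

section CoxGeom
open Classical Polynomial.Chebyshev
variable {α : Type} {m : α → α → ℕ∞}

/-- The entries of the generalised Cartan matrix. -/
noncomputable def cartanEntry (m : α → α → ℕ∞) (s t : α) : ℝ :=
  if s = t then 2 else if m s t = ⊤ then -2 else -2 * Real.cos (Real.pi / ((m s t).toNat : ℝ))

theorem cartanEntry_self (s : α) : cartanEntry m s s = 2 := by simp [cartanEntry]

/-- The simple coroot. -/
noncomputable def simpleCoroot (m : α → α → ℕ∞) (s : α) : Module.Dual ℝ (α →₀ ℝ) :=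
  Finsupp.lsum ℝ (fun t => cartanEntry m s t • LinearMap.id)

theorem simpleCoroot_apply (s t : α) :
    simpleCoroot m s (Finsupp.single t 1) = cartanEntry m s t := by
  simp [simpleCoroot]

theorem simpleCoroot_self (s : α) : simpleCoroot m s (Finsupp.single s 1) = 2 := by
  rw [simpleCoroot_apply, cartanEntry_self]

/-- The simple reflection. -/
noncomputable def simpleRefl (m : α → α → ℕ∞) (s : α) : (α →₀ ℝ) ≃ₗ[ℝ] (α →₀ ℝ) :=
  Module.reflection (simpleCoroot_self (m := m) s)

theorem cartanEntry_fin (n : ℕ) {s t : α} (hst : s ≠ t) (h : m s t = n) :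
    cartanEntry m s t = -2 * Real.cos (Real.pi / n) := by
  simp [cartanEntry, hst, h]

theorem S_sin (k : ℤ) (θ : ℝ) :
    (S ℝ k).eval (2 * Real.cos θ) * Real.sin θ = Real.sin ((k + 1) * θ) :=
  S_two_mul_real_cos θ k

theorem sin_theta_ne {n : ℕ} (hn : 3 ≤ n) : Real.sin (2 * Real.pi / n) ≠ 0 := by
  apply ne_of_gt
  have h3 : (3 : ℝ) ≤ n := by exact_mod_cast hn
  apply Real.sin_pos_of_pos_of_lt_pi
  · positivity
  · rw [div_lt_iff₀ (by linarith)]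
    nlinarith [Real.pi_pos]

theorem cos_half_ne {n : ℕ} (hn : 3 ≤ n) : Real.cos (Real.pi / n) ≠ 0 := by
  apply ne_of_gt
  have h3 : (3 : ℝ) ≤ n := by exact_mod_cast hn
  apply Real.cos_pos_of_mem_Ioo
  constructor
  · have : 0 < Real.pi / n := by positivity
    linarith [Real.pi_pos]
  · rw [div_lt_iff₀ (by linarith)]
    nlinarith [Real.pi_pos]

theorem t_eq (n : ℕ) : 2 * Real.cos (2 * Real.pi / n) =
    (-2 * Real.cos (Real.pi / n)) * (-2 * Real.cos (Real.pi / n)) - 2 := by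
  rw [mul_div_assoc, Real.cos_two_mul]; ring

theorem S_prod_zero {n : ℕ} (hn : 3 ≤ n) :
    (S ℝ (((n : ℤ) - 2) / 2)).eval (2 * Real.cos (2 * Real.pi / n)) *
      ((S ℝ (((n : ℤ) - 1) / 2)).eval (2 * Real.cos (2 * Real.pi / n)) +
        (S ℝ (((n : ℤ) - 3) / 2)).eval (2 * Real.cos (2 * Real.pi / n))) = 0 ∧
    (S ℝ (((n : ℤ) - 1) / 2)).eval (2 * Real.cos (2 * Real.pi / n)) *
      ((S ℝ ((n : ℤ) / 2)).eval (2 * Real.cos (2 * Real.pi / n)) +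
        (S ℝ (((n : ℤ) - 2) / 2)).eval (2 * Real.cos (2 * Real.pi / n))) = 0 := by
  have hs := sin_theta_ne hn
  have hn0 : (n : ℝ) ≠ 0 := by positivity
  have hS := fun k => S_sin k (2 * Real.pi / n)
  set θ := 2 * Real.pi / n with hθ
  have hnθ : n * θ = 2 * Real.pi := by rw [hθ]; field_simp
  clear_value θ
  rcases Nat.even_or_odd' n with ⟨k, rfl | rfl⟩
  · have h0 : (S ℝ ((k : ℤ) - 1)).eval (2 * Real.cos θ) = 0 := by
      have := hS (k - 1)
      have h2 : (((k : ℤ) - 1 : ℤ) + 1 : ℝ) * θ = Real.pi := by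
        push_cast at hnθ ⊢; linarith
      rw [h2, Real.sin_pi] at this
      exact (mul_eq_zero.mp this).resolve_right hs
    have e1 : (((2 * k : ℕ) : ℤ) - 2) / 2 = k - 1 := by omega
    have e2 : (((2 * k : ℕ) : ℤ) - 1) / 2 = k - 1 := by omega
    rw [e1, e2, h0]; simp
  · have h0 : (S ℝ (k : ℤ)).eval (2 * Real.cos θ) +
        (S ℝ ((k : ℤ) - 1)).eval (2 * Real.cos θ) = 0 := by
      have h1 := hS (k - 1)
      have h2 := hS k
      have h3 : (((k : ℤ) : ℝ) + 1) * θ = 2 * Real.pi - (((k : ℤ) - 1 : ℤ) + 1 : ℝ) * θ := by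
        push_cast at hnθ ⊢; linarith
      rw [h3, Real.sin_two_pi_sub, ← h1] at h2
      have : ((S ℝ (k : ℤ)).eval (2 * Real.cos θ) +
        (S ℝ ((k : ℤ) - 1)).eval (2 * Real.cos θ)) * Real.sin θ = 0 := by linarith
      exact (mul_eq_zero.mp this).resolve_right hs
    have e1 : (((2 * k + 1 : ℕ) : ℤ) - 2) / 2 = k - 1 := by omega
    have e2 : (((2 * k + 1 : ℕ) : ℤ) - 1) / 2 = k := by omega
    have e3 : (((2 * k + 1 : ℕ) : ℤ) - 3) / 2 = k - 1 := by omega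
    have e4 : (((2 * k + 1 : ℕ) : ℤ)) / 2 = k := by omega
    rw [e1, e2, e3, e4, h0]; simp

theorem simpleRefl_rel (hsymm : ∀ s t, m s t = m t s) (h2 : ∀ s t, s ≠ t → 2 ≤ m s t)
    {s t : α} {n : ℕ} (hst : s ≠ t) (h : m s t = n) :
    (simpleRefl m s * simpleRefl m t) ^ n = 1 := by
  have hn : 2 ≤ n := by have := h2 s t hst; rw [h] at this; exact_mod_cast this
  have c1 := cartanEntry_fin n hst h
  have c2 := cartanEntry_fin n hst.symm ((hsymm t s).trans h)
  ext1 z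
  rcases hn.eq_or_lt with rfl | hn
  · have c0 : Real.cos (Real.pi / ((2 : ℕ) : ℝ)) = 0 := by simp
    rw [c0, mul_zero, ← simpleCoroot_apply] at c1 c2
    simp only [simpleRefl, pow_two, LinearEquiv.mul_apply, Module.reflection_apply, map_sub,
      map_smul, simpleCoroot_self, c1, c2, LinearEquiv.coe_one, id]
    module
  · rw [simpleRefl, simpleRefl, Module.reflection_mul_reflection_pow_apply _ _ n z
      (2 * Real.cos (2 * Real.pi / n))
      (by rw [simpleCoroot_apply, simpleCoroot_apply, c1, c2, t_eq])]
    rw [(S_prod_zero hn).1, (S_prod_zero hn).2]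
    simp

theorem simpleRefl_sq (s : α) : simpleRefl m s * simpleRefl m s = 1 := by
  apply LinearEquiv.ext
  intro z
  rw [LinearEquiv.mul_apply, LinearEquiv.coe_one, id, simpleRefl]
  exact Module.involutive_reflection _ z

/-- The geometric representation. -/
noncomputable def geomRep (hsymm : ∀ s t, m s t = m t s) (h2 : ∀ s t, s ≠ t → 2 ≤ m s t) :
    CoxGroup m →* ((α →₀ ℝ) ≃ₗ[ℝ] (α →₀ ℝ)) :=
  coxLift (simpleRefl m)
    simpleRefl_sq
    (fun _ _ _ hst h => simpleRefl_rel hsymm h2 hst h)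

theorem coxOf_order (hsymm : ∀ s t, m s t = m t s) (h2 : ∀ s t, s ≠ t → 2 ≤ m s t)
    {s t : α} (hst : s ≠ t) {p : ℕ} (hp : 0 < p) (h : (coxOf m s * coxOf m t) ^ p = 1) :
    ∃ n : ℕ, m s t = n ∧ n ∣ p := by
  have h1 := congrArg (geomRep hsymm h2) h
  rw [map_pow, map_mul, map_one, geomRep, coxLift_of, coxLift_of] at h1
  have key : ∀ T : ℝ, T = cartanEntry m s t * cartanEntry m t s - 2 →
      (S ℝ p).eval T + (S ℝ (p - 1)).eval T = 1 ∧
        (S ℝ (p - 1)).eval T * -cartanEntry m t s = 0 := by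
    intro T hT
    have h3 := Module.reflection_mul_reflection_pow_apply_self (simpleCoroot_self (m := m) s)
      (simpleCoroot_self (m := m) t) p T (by rw [simpleCoroot_apply, simpleCoroot_apply, hT])
    change ((simpleRefl m s * simpleRefl m t) ^ p) _ = _ at h3
    rw [h1] at h3
    have a1 := DFunLike.congr_fun h3 s
    have a2 := DFunLike.congr_fun h3 t
    simp [hst, hst.symm] at a1 a2
    constructor
    · exact a1.symm
    · rw [mul_neg, neg_eq_zero, mul_eq_zero, ← simpleCoroot_apply]; exact a2
  by_cases htop : m s t = ⊤
  · exfalso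
    have c1 : cartanEntry m s t = -2 := by simp [cartanEntry, hst, htop]
    have c2 : cartanEntry m t s = -2 := by simp [cartanEntry, hst.symm, hsymm t s, htop]
    obtain ⟨-, k2⟩ := key 2 (by rw [c1, c2]; norm_num)
    rw [S_eval_two, c2] at k2
    push_cast at k2
    have : (0 : ℝ) < p := by exact_mod_cast hp
    linarith
  · obtain ⟨n, hn⟩ := ENat.ne_top_iff_exists.mp htop
    refine ⟨n, hn.symm, ?_⟩
    have h2n : 2 ≤ n := by have := h2 s t hst; rw [← hn] at this; exact_mod_cast this
    have c1 := cartanEntry_fin n hst hn.symm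
    have c2 := cartanEntry_fin n hst.symm ((hsymm t s).trans hn.symm)
    rcases h2n.eq_or_lt with rfl | h3
    · have c0 : Real.cos (Real.pi / ((2 : ℕ) : ℝ)) = 0 := by simp
      obtain ⟨k1, -⟩ := key (-2) (by rw [c1, c2, c0]; norm_num)
      rw [S_eval_neg_two, S_eval_neg_two] at k1
      rcases Nat.even_or_odd p with hev | hodd
      · exact hev.two_dvd
      · exfalso
        have o1 : Odd (p : ℤ) := by exact_mod_cast hodd
        rw [Int.negOnePow_odd _ o1, Int.negOnePow_even _ (o1.sub_odd odd_one)] at k1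
        push_cast at k1
        simp at k1
        linarith
    · obtain ⟨k1, k2⟩ := key (2 * Real.cos (2 * Real.pi / n)) (by rw [c1, c2, t_eq])
      have hs := sin_theta_ne h3
      have hc := cos_half_ne h3
      have k3 : (S ℝ (p - 1)).eval (2 * Real.cos (2 * Real.pi / n)) = 0 := by
        rcases mul_eq_zero.mp k2 with h | h
        · exact h
        · exfalso; rw [c2] at h; apply hc; linarith
      rw [k3, add_zero] at k1
      have s1 := S_sin p (2 * Real.pi / n)
      have s2 := S_sin (p - 1) (2 * Real.pi / n)
      rw [k1, one_mul] at s1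
      rw [k3, zero_mul] at s2
      push_cast at s1 s2
      rw [sub_add_cancel] at s2
      rw [add_mul, one_mul, Real.sin_add, ← s2, zero_mul, zero_add] at s1
      have s3 : Real.cos (p * (2 * Real.pi / n)) = 1 := by
        have : (Real.cos (p * (2 * Real.pi / n)) - 1) * Real.sin (2 * Real.pi / n) = 0 := by
          linarith
        have := (mul_eq_zero.mp this).resolve_right hs
        linarith
      obtain ⟨k, hk⟩ := (Real.cos_eq_one_iff _).mp s3
      have hn0 : (n : ℝ) ≠ 0 := by positivity
      have hpk : (k : ℝ) * n = p := by
        have hpi := Real.pi_pos.ne'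
        field_simp at hk
        exact hk
      have : (k * n : ℤ) = p := by exact_mod_cast hpk
      exact Int.natCast_dvd_natCast.mp ⟨k, by rw [← this]; ring⟩

end CoxGeom

section CoxPara
variable {α β : Type} {m : α → α → ℕ∞} {m' : β → β → ℕ∞}

/-- The parity homomorphism. -/
def coxSign (m : α → α → ℕ∞) : CoxGroup m →* Multiplicative (ZMod 2) :=
  coxLift (fun _ => Multiplicative.ofAdd 1) (fun _ => rfl) (fun _ _ n _ _ => by
    rw [show (Multiplicative.ofAdd (1 : ZMod 2) * Multiplicative.ofAdd 1) = 1 from rfl, one_pow])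

theorem coxSign_word (x : List α) :
    coxSign m (coxWord m x) = Multiplicative.ofAdd (x.length : ZMod 2) := by
  induction x with
  | nil => simp
  | cons a x ih =>
    rw [coxWord_cons, map_mul, ih, coxSign, coxLift_of, List.length_cons, ← ofAdd_add]
    push_cast; rw [add_comm]

theorem even_of_coxWord_eq_one {x : List α} (h : coxWord m x = 1) : Even x.length := by
  have := coxSign_word (m := m) x
  rw [h, map_one] at this
  have h2 : (x.length : ZMod 2) = 0 := (Multiplicative.ofAdd.injective this).symm
  exact (ZMod.natCast_eq_zero_iff_even).mp h2

/-- Alternating words. -/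
def altWord (a b : α) : ℕ → List α
  | 0 => []
  | n + 1 => a :: altWord b a n

theorem altWord_length (a b : α) (n : ℕ) : (altWord a b n).length = n := by
  induction n generalizing a b with
  | zero => rfl
  | succ n ih => simp [altWord, ih]

theorem altWord_dropLast (a b : α) (n : ℕ) : (altWord a b (n + 1)).dropLast = altWord a b n := by
  induction n generalizing a b with
  | zero => rfl
  | succ n ih =>
    rw [altWord, List.dropLast_cons_of_ne_nil (by simp [altWord]), ih]
    rfl

theorem altWord_rel (a b : α) (n : ℕ) :
    coxWord m (altWord a b n) = (coxOf m a * coxOf m b) ^ n * coxWord m (altWord b a n) := by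
  induction n generalizing a b with
  | zero => simp [altWord]
  | succ n ih =>
    rw [altWord, altWord, coxWord_cons, coxWord_cons, ih b a, pow_succ]
    have h1 : coxOf m a * (coxOf m b * coxOf m a) ^ n =
        (coxOf m a * coxOf m b) ^ n * coxOf m a := by
      rw [mul_pow_mul]
    calc _ = coxOf m a * (coxOf m b * coxOf m a) ^ n * coxWord m (altWord a b n) := by
          simp only [mul_assoc]
      _ = (coxOf m a * coxOf m b) ^ n * coxOf m a * (coxOf m b * coxOf m b) *
          coxWord m (altWord a b n) := by rw [h1, coxOf_sq, mul_one]
      _ = _ := by simp only [mul_assoc]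

/-- The key statement for words of length `p`. -/
def ParaBelow (m : α → α → ℕ∞) (m' : β → β → ℕ∞) (i : α → β) (k : ℕ) : Prop :=
  ∀ x y : List α, x.length + y.length < k → coxWord m' (x.map i) = coxWord m' (y.map i) →
    coxWord m x = coxWord m y

theorem para_step (i : α → β) {p : ℕ} (IH : ParaBelow m m' i (2 * p)) (a : α) (x y : List α)
    (hx : x.length + 1 = p) (hy : y.length = p)
    (h : coxWord m' ((a :: x).map i) = coxWord m' (y.map i)) :
    coxWord m (a :: x) = coxWord m y ∨
      (coxWord m (a :: x) = coxWord m (a :: y.dropLast) ∧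
        coxWord m' (y.map i) = coxWord m' ((a :: y.dropLast).map i)) := by
  have hc := cocCount_congr h (coxOf m' (i a))
  rw [List.map_cons, cocCount, delta2, if_pos rfl, coxOf_sq, one_mul] at hc
  by_cases h0 : cocCount m' (x.map i) (coxOf m' (i a)) = 0
  · rw [h0, add_zero] at hc
    obtain ⟨z1, c, z2, hz, hr⟩ := exists_of_cocCount_ne (y := y.map i) (r := coxOf m' (i a))
      (by rw [← hc]; decide)
    obtain ⟨y1, y', rfl, rfl, hy'⟩ := List.map_eq_append_iff.mp hz
    obtain ⟨b, y2, rfl, rfl, rfl⟩ := List.map_eq_cons_iff.mp hy'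
    have hx' : coxWord m' (x.map i) = coxWord m' ((y1 ++ y2).map i) := by
      simp only [List.map_cons, List.map_append, coxWord_cons, coxWord_append] at h ⊢
      rw [← mul_assoc, ← hr, mul_assoc] at h
      exact mul_left_cancel h
    have hx2 : coxWord m x = coxWord m (y1 ++ y2) :=
      IH _ _ (by simp at hy ⊢; omega) hx'
    rcases y2.eq_nil_or_concat with rfl | ⟨y3, c, rfl⟩
    · right
      simp only [List.dropLast_concat]
      constructor
      · rw [coxWord_cons, hx2, coxWord_cons]; simp
      · simp [hr]
    · left
      have h1 : coxWord m (a :: y1) = coxWord m (y1 ++ [b]) :=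
        IH _ _ (by simp at hy ⊢; omega) (by simp [hr])
      rw [coxWord_cons, hx2]
      simp only [coxWord_append, coxWord_cons, coxWord_nil, mul_one] at h1 ⊢
      rw [← mul_assoc, h1]
      simp only [mul_assoc]
  · left
    obtain ⟨z1, c, z2, hz, hr⟩ := exists_of_cocCount_ne h0
    obtain ⟨x1, x', rfl, rfl, hx'⟩ := List.map_eq_append_iff.mp hz
    obtain ⟨b, x2, rfl, rfl, rfl⟩ := List.map_eq_cons_iff.mp hx'
    have e1 : coxWord m' ((a :: (x1 ++ b :: x2)).map i) = coxWord m' ((x1 ++ x2).map i) := by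
      simp only [List.map_cons, List.map_append, coxWord_cons, coxWord_append]
      rw [← mul_assoc, hr, mul_assoc, ← mul_assoc (coxOf m' (i b)), coxOf_sq, one_mul]
    have e2 := IH _ _ (by simp at hx ⊢; omega) e1
    have e3 := IH y (x1 ++ x2) (by simp at hx ⊢; omega) (by rw [← h, e1])
    rw [e2, e3]

theorem para_alt (i : α → β) {p : ℕ} (IH : ParaBelow m m' i (2 * p))
    (halt : ∀ a b, coxWord m' ((altWord a b p).map i) = coxWord m' ((altWord b a p).map i) →
      coxWord m (altWord a b p) = coxWord m (altWord b a p))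
    (n : ℕ) : ∀ (k : ℕ) (a b : α) (u v : List α), k + 1 + n = p → 0 < k → u.length = n →
      v.length = n + 1 →
      coxWord m' ((altWord a b (k + 1) ++ u).map i) = coxWord m' ((altWord b a k ++ v).map i) →
      coxWord m (altWord a b (k + 1) ++ u) = coxWord m (altWord b a k ++ v) := by
  induction n with
  | zero =>
    intro k a b u v hk hk0 hu hv h
    obtain rfl : u = [] := List.length_eq_zero_iff.mp hu
    obtain ⟨k, rfl⟩ : ∃ j, k = j + 1 := ⟨k - 1, by omega⟩
    have h' := para_step i IH b (altWord a b k ++ v) (altWord a b (k + 1 + 1) ++ [])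
      (by simp [altWord_length]; omega) (by simp [altWord_length]; omega) (by rw [h]; rfl)
    rcases h' with h' | ⟨h1, h2⟩
    · rw [← h']; rfl
    · rw [List.append_nil, altWord_dropLast] at h1 h2
      have h3 := halt a b (by rw [← hk]; exact h2)
      rw [← hk] at h3
      rw [List.append_nil]
      exact h3.trans h1.symm
  | succ n ih =>
    intro k a b u v hk hk0 hu hv h
    obtain ⟨k, rfl⟩ : ∃ j, k = j + 1 := ⟨k - 1, by omega⟩
    have h' := para_step i IH b (altWord a b k ++ v) (altWord a b (k + 1 + 1) ++ u)
      (by simp [altWord_length]; omega) (by simp [altWord_length]; omega) (by rw [h]; rfl)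
    rcases h' with h' | ⟨h1, h2⟩
    · rw [← h']; rfl
    · have hune : u ≠ [] := by rintro rfl; simp at hu
      rw [List.dropLast_append_of_ne_nil hune] at h1 h2
      have h3 := ih (k + 1 + 1) b a u.dropLast u (by omega) (by omega) (by simp [hu]) hu h2.symm
      exact h3.symm.trans h1.symm

theorem para_halves (i : α → β) (hi : Function.Injective i)
    (hm : ∀ s t, s ≠ t → m' (i s) (i t) = m s t)
    (hsymm : ∀ s t, m' s t = m' t s) (h2 : ∀ s t, s ≠ t → 2 ≤ m' s t)
    {p : ℕ} (hp : 0 < p) (IH : ParaBelow m m' i (2 * p)) (x y : List α)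
    (hx : x.length = p) (hy : y.length = p) (h : coxWord m' (x.map i) = coxWord m' (y.map i)) :
    coxWord m x = coxWord m y := by
  have halt : ∀ a b, coxWord m' ((altWord a b p).map i) = coxWord m' ((altWord b a p).map i) →
      coxWord m (altWord a b p) = coxWord m (altWord b a p) := by
    intro a b hab
    have hmap : ∀ (n : ℕ) (a b : α), (altWord a b n).map i = altWord (i a) (i b) n := by
      intro n
      induction n with
      | zero => intros; rfl
      | succ n ih => intro a b; simp [altWord, ih]
    rcases eq_or_ne a b with rfl | hne
    · rfl
    rw [hmap, hmap, altWord_rel] at hab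
    have h1 : (coxOf m' (i a) * coxOf m' (i b)) ^ p = 1 := by simpa using hab
    obtain ⟨n, hn, d, rfl⟩ := coxOf_order hsymm h2 (hi.ne hne) hp h1
    rw [altWord_rel, pow_mul, coxOf_rel hne (by rw [← hn, hm _ _ hne]), one_pow, one_mul]
  obtain ⟨a, x, rfl⟩ : ∃ a x', x = a :: x' := List.exists_cons_of_length_pos (by omega)
  obtain ⟨b, y, rfl⟩ : ∃ b y', y = b :: y' := List.exists_cons_of_length_pos (by omega)
  rcases para_step i IH a x (b :: y) hx hy h with h' | ⟨h1, h3⟩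
  · exact h'
  · rw [h1]
    rcases y.eq_nil_or_concat with rfl | ⟨y3, c, rfl⟩
    · obtain rfl : p = 1 := by simpa using hy.symm
      exact halt a b h3.symm
    · simp only [List.concat_eq_append, ← List.cons_append, List.dropLast_concat] at h1 h3 hy ⊢
      exact para_alt i IH halt y3.length 1 a b y3 (y3 ++ [c]) (by simp at hy; omega) (by omega) rfl
        (by simp) h3.symm

theorem para_below (i : α → β) (hi : Function.Injective i)
    (hm : ∀ s t, s ≠ t → m' (i s) (i t) = m s t)
    (hsymm : ∀ s t, m' s t = m' t s) (h2 : ∀ s t, s ≠ t → 2 ≤ m' s t) (k : ℕ) :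
    ParaBelow m m' i (2 * k) := by
  induction k with
  | zero => intro x y h; omega
  | succ p ih =>
    intro x y hxy h
    have h1 : coxWord m' ((x ++ y.reverse).map i) = 1 := by
      rw [List.map_append, coxWord_append, List.map_reverse, coxWord_reverse, h, mul_inv_cancel]
    have hev := even_of_coxWord_eq_one h1
    simp only [List.length_map, List.length_append, List.length_reverse] at hev
    by_cases hlt : x.length + y.length < 2 * p
    · exact ih x y hlt h
    have heq : x.length + y.length = 2 * p := by
      obtain ⟨d, hd⟩ := hev; omega
    rcases Nat.eq_zero_or_pos p with rfl | hp
    · obtain rfl : x = [] := List.length_eq_zero_iff.mp (by omega)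
      obtain rfl : y = [] := List.length_eq_zero_iff.mp (by omega)
      rfl
    set z := x ++ y.reverse with hz
    have hzl : z.length = 2 * p := by simp [hz, heq]
    have e1 : coxWord m' ((z.take p).map i) = coxWord m' ((z.drop p).reverse.map i) := by
      rw [List.map_reverse, coxWord_reverse, ← mul_eq_one_iff_eq_inv, ← coxWord_append,
        ← List.map_append, List.take_append_drop, h1]
    have e2 := para_halves i hi hm hsymm h2 hp ih _ _ (by simp [hzl]; omega)
      (by simp [hzl]; omega) e1
    rw [coxWord_reverse, ← mul_eq_one_iff_eq_inv, ← coxWord_append, List.take_append_drop, hz,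
      coxWord_append, coxWord_reverse, mul_inv_eq_one] at e2
    exact e2

/-- The homomorphism of Coxeter groups induced by a label-preserving injection. -/
def coxMap (i : α → β) (hi : Function.Injective i)
    (hm : ∀ s t, s ≠ t → m' (i s) (i t) = m s t) : CoxGroup m →* CoxGroup m' :=
  coxLift (fun s => coxOf m' (i s)) (fun _ => coxOf_sq _)
    (fun s t _ hst h => coxOf_rel (hi.ne hst) ((hm s t hst).trans h))

@[simp] theorem coxMap_of (i : α → β) (hi : Function.Injective i)
    (hm : ∀ s t, s ≠ t → m' (i s) (i t) = m s t) (s : α) :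
    coxMap i hi hm (coxOf m s) = coxOf m' (i s) := coxLift_of _ _ _ _

theorem coxMap_injective (i : α → β) (hi : Function.Injective i)
    (hm : ∀ s t, s ≠ t → m' (i s) (i t) = m s t)
    (hsymm : ∀ s t, m' s t = m' t s) (h2 : ∀ s t, s ≠ t → 2 ≤ m' s t) :
    Function.Injective (coxMap i hi hm) := by
  have hw : ∀ x, coxMap i hi hm (coxWord m x) = coxWord m' (x.map i) := by
    intro x
    induction x with
    | nil => simp
    | cons a x ih => simp [ih]
  intro w1 w2 h
  obtain ⟨x, rfl⟩ := coxWord_surj w1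
  obtain ⟨y, rfl⟩ := coxWord_surj w2
  rw [hw, hw] at h
  exact para_below i hi hm hsymm h2 (x.length + y.length + 1) x y (by omega) h

end CoxPara

section Eppa
open Classical

/-- Extension property for a single partial automorphism of a finite labelled graph. -/
theorem exists_extension (S : Type) [Fintype S] (m : S → S → ℕ∞)
    (hsymm : ∀ s t, m s t = m t s) (h2 : ∀ s t, s ≠ t → 2 ≤ m s t)
    (S' : Set S) (φ : S → S) (hinj : Set.InjOn φ S')
    (hpres : ∀ s ∈ S', ∀ t ∈ S', m s t = m (φ s) (φ t)) :
    ∃ (β : Type) (_ : Fintype β) (m' : β → β → ℕ∞) (i : S → β) (π : Equiv.Perm β),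
      Function.Injective i ∧ (∀ s t, s ≠ t → m' (i s) (i t) = m s t) ∧
      (∀ a b, m' a b = m' b a) ∧ (∀ a b, a ≠ b → 2 ≤ m' a b) ∧
      (∀ a b, m' a b = ⊤ ∨ ∃ s t : S, s ≠ t ∧ m' a b = m s t) ∧
      (∀ a b, m' (π a) (π b) = m' a b) ∧ (∀ s ∈ S', π (i s) = i (φ s)) := by
  let K := S × S → ZMod 2
  have hK : ∀ k : K, k + k = 0 := fun k => by ext q; exact zmod2_add_self _
  let code : S → S → K := fun x y q => if m q.1 q.2 = m x y then 1 else 0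
  have code_congr : ∀ x y x' y', m x y = m x' y' → code x y = code x' y' := by
    intro x y x' y' h; simp only [code, h]
  have code_inj : ∀ x y x' y', code x y = code x' y' → m x y = m x' y' := by
    intro x y x' y' h
    have := congrFun h (x, y)
    by_contra hne
    simp [code, hne] at this
  let lab : K → ℕ∞ := fun k =>
    if h : ∃ s t, s ≠ t ∧ k = code s t then m h.choose h.choose_spec.choose else ⊤
  have lab_code : ∀ s t, s ≠ t → lab (code s t) = m s t := by
    intro s t hst
    have h : ∃ s' t', s' ≠ t' ∧ code s t = code s' t' := ⟨s, t, hst, rfl⟩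
    simp only [lab, dif_pos h]
    exact (code_inj _ _ _ _ h.choose_spec.choose_spec.2).symm
  have lab_or : ∀ k, lab k = ⊤ ∨ ∃ s t : S, s ≠ t ∧ lab k = m s t := by
    intro k
    by_cases h : ∃ s t, s ≠ t ∧ k = code s t
    · right
      obtain ⟨s, t, hst, rfl⟩ := h
      exact ⟨s, t, hst, lab_code s t hst⟩
    · left; simp only [lab, dif_neg h]
  let e := Fintype.equivFin S
  let chi : S → S → K := fun x y => if e x < e y then code x y else 0
  have chi_add : ∀ x y, x ≠ y → chi x y + chi y x = code x y := by
    intro x y hxy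
    have hne : e x ≠ e y := e.injective.ne hxy
    rcases lt_or_gt_of_ne hne with h | h
    · simp [chi, h, h.not_gt]
    · simp [chi, h, h.not_gt, code_congr y x x y (hsymm y x)]
  let ρ : Equiv.Perm S := Equiv.extendSubtype (p := (· ∈ S')) (q := (· ∈ φ '' S'))
    (Set.BijOn.equiv φ hinj.bijOn_image)
  have hρ : ∀ s ∈ S', ρ s = φ s := by
    intro s hs
    exact Equiv.extendSubtype_apply_of_mem _ s hs
  let c : S → S → K := fun x y =>
    if x ∈ S' then chi (ρ x) (ρ y) + chi x y
    else if y ∈ S' then chi (ρ y) (ρ x) + chi y x else 0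
  have c_symm : ∀ x y, x ≠ y → c x y = c y x := by
    intro x y hxy
    by_cases hx : x ∈ S' <;> by_cases hy : y ∈ S'
    · simp only [c, hx, hy, if_true]
      have h1 := chi_add x y hxy
      have h3 := chi_add (ρ x) (ρ y) (ρ.injective.ne hxy)
      have h4 : code (ρ x) (ρ y) = code x y :=
        code_congr _ _ _ _ (by rw [hρ x hx, hρ y hy, hpres x hx y hy])
      rw [h4, ← h1] at h3
      have h5 := hK (chi (ρ y) (ρ x))
      have h6 := hK (chi x y)
      calc chi (ρ x) (ρ y) + chi x y
          = (chi (ρ x) (ρ y) + chi (ρ y) (ρ x)) + chi x y - chi (ρ y) (ρ x) := by abel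
        _ = (chi x y + chi x y) + chi y x - (chi (ρ y) (ρ x) + chi (ρ y) (ρ x)) +
            chi (ρ y) (ρ x) := by rw [h3]; abel
        _ = _ := by rw [h5, h6]; abel
    · simp [c, hx, hy]
    · simp [c, hx, hy]
    · simp [c, hx, hy]
  let lbl : S × (S → K) → S × (S → K) → ℕ∞ := fun a b =>
    if a.1 = b.1 then ⊤ else lab (a.2 b.1 + b.2 a.1)
  let π : Equiv.Perm (S × (S → K)) :=
    { toFun := fun a => (ρ a.1, fun z => a.2 (ρ.symm z) + c a.1 (ρ.symm z))
      invFun := fun a => (ρ.symm a.1, fun z => a.2 (ρ z) + c (ρ.symm a.1) z)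
      left_inv := by
        rintro ⟨x, χ⟩
        simp [add_assoc, hK]
      right_inv := by
        rintro ⟨x, χ⟩
        simp [add_assoc, hK] }
  refine ⟨S × (S → K), inferInstance, lbl, fun s => (s, chi s), π, ?_, ?_, ?_, ?_, ?_, ?_, ?_⟩
  · intro a b h; exact (Prod.mk.inj h).1
  · intro s t hst
    simp only [lbl, hst, if_false]
    rw [chi_add s t hst, lab_code s t hst]
  · intro a b
    simp only [lbl, eq_comm (a := a.1), add_comm (a.2 b.1)]
  · intro a b _
    simp only [lbl]
    split_ifs with h
    · exact le_top
    · rcases lab_or (a.2 b.1 + b.2 a.1) with h | ⟨s, t, hst, h⟩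
      · rw [h]; exact le_top
      · rw [h]; exact h2 s t hst
  · intro a b
    simp only [lbl]
    split_ifs with h
    · exact Or.inl rfl
    · exact lab_or _
  · rintro ⟨x, χ⟩ ⟨y, ξ⟩
    simp only [lbl, π, Equiv.coe_fn_mk, Equiv.symm_apply_apply, EmbeddingLike.apply_eq_iff_eq]
    split_ifs with h
    · rfl
    · congr 1
      rw [c_symm x y h]
      calc _ = χ y + ξ x + (c y x + c y x) := by abel
        _ = _ := by rw [hK, add_zero]
  · intro s hs
    simp only [π, Equiv.coe_fn_mk, Prod.mk.injEq]
    refine ⟨hρ s hs, ?_⟩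
    funext z
    simp only [c, hs, if_true, Equiv.apply_symm_apply, hρ s hs]
    rw [add_left_comm, hK, add_zero]

end Eppa

section Induced
open Classical

/-- The setoid defining the induced set. -/
def indSetoid {W P G : Type} [Group W] [Group P] [Group G] (j : W →* P) (k : W →* G) :
    Setoid (P × G) where
  r a b := ∃ w, b.1 = a.1 * j w ∧ a.2 = k w * b.2
  iseqv :=
    { refl := fun a => ⟨1, by simp, by simp⟩
      symm := by
        rintro a b ⟨w, h1, h2⟩
        exact ⟨w⁻¹, by simp [h1], by simp [h2]⟩
      trans := by
        rintro a b c ⟨w, h1, h2⟩ ⟨v, h3, h4⟩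
        exact ⟨w * v, by simp [h1, h3, mul_assoc], by simp [h2, h4, mul_assoc]⟩ }

/-- Induced sets. -/
theorem exists_induced {W P G : Type} [Group W] [Group P] [Group G] (j : W →* P) (k : W →* G) :
    ∃ (X : Type) (a : P →* Equiv.Perm X) (e : P → G → X),
      (∀ p q g, a p (e q g) = e (p * q) g) ∧ (∀ q w g, e (q * j w) g = e q (k w * g)) ∧
      (∀ q g q' g', e q g = e q' g' → ∃ w, q' = q * j w ∧ g = k w * g') := by
  let act : P → Quotient (indSetoid j k) → Quotient (indSetoid j k) := fun p =>
    Quotient.map (fun a => (p * a.1, a.2)) (by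
      rintro a b ⟨w, h1, h2⟩
      exact ⟨w, by simp [h1, mul_assoc], h2⟩)
  have act_mul : ∀ p q x, act (p * q) x = act p (act q x) := by
    intro p q x
    induction x using Quotient.inductionOn with
    | h a => simp [act, mul_assoc]
  have act_one : ∀ x, act 1 x = x := by
    intro x
    induction x using Quotient.inductionOn with
    | h a => simp [act]
  refine ⟨Quotient (indSetoid j k),
    MonoidHom.toHomPerm (G := P)
      { toFun := fun p => act p
        map_one' := funext act_one
        map_mul' := fun p q => funext (act_mul p q) },
    fun q g => Quotient.mk _ (q, g), ?_, ?_, ?_⟩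
  · intro p q g; rfl
  · intro q w g
    exact (Quotient.sound (s := indSetoid j k) ⟨w, rfl, rfl⟩).symm
  · intro q g q' g' h
    exact Quotient.exact (s := indSetoid j k) h

/-- Partial involutions exchanging two disjoint copies of a set. -/
theorem exists_swapPerm {G X : Type} (e1 e2 : G → X) (h1 : Function.Injective e1)
    (h2 : Function.Injective e2) (hd : ∀ g g', e1 g ≠ e2 g') :
    ∃ u : Equiv.Perm X, u * u = 1 ∧ (∀ g, u (e1 g) = e2 g) ∧
      ∀ b : Equiv.Perm X, b * b = 1 →
        (∃ γ : G → G, ∀ g, b (e1 g) = e1 (γ g) ∧ b (e2 g) = e2 (γ g)) → Commute u b := by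
  let f : X → X := fun x => if h : ∃ g, e1 g = x then e2 h.choose
    else if h : ∃ g, e2 g = x then e1 h.choose else x
  have f1 : ∀ g, f (e1 g) = e2 g := by
    intro g
    have h : ∃ g', e1 g' = e1 g := ⟨g, rfl⟩
    simp only [f, dif_pos h]
    rw [h1 h.choose_spec]
  have f2 : ∀ g, f (e2 g) = e1 g := by
    intro g
    have h : ∃ g', e2 g' = e2 g := ⟨g, rfl⟩
    have h' : ¬ ∃ g', e1 g' = e2 g := fun ⟨g', hg⟩ => hd _ _ hg
    simp only [f, dif_neg h', dif_pos h]
    rw [h2 h.choose_spec]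
  have f3 : ∀ x, (¬ ∃ g, e1 g = x) → (¬ ∃ g, e2 g = x) → f x = x := by
    intro x hx hx'
    simp only [f, dif_neg hx, dif_neg hx']
  have hf : Function.Involutive f := by
    intro x
    by_cases hx : ∃ g, e1 g = x
    · obtain ⟨g, rfl⟩ := hx; rw [f1, f2]
    by_cases hx' : ∃ g, e2 g = x
    · obtain ⟨g, rfl⟩ := hx'; rw [f2, f1]
    rw [f3 x hx hx', f3 x hx hx']
  refine ⟨hf.toPerm, ?_, f1, ?_⟩
  · ext x; exact hf x
  · rintro b hb ⟨γ, hγ⟩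
    have hbb : ∀ x, b (b x) = x := fun x => by
      rw [← Equiv.Perm.mul_apply, hb, Equiv.Perm.one_apply]
    ext x
    change f (b x) = b (f x)
    by_cases hx : ∃ g, e1 g = x
    · obtain ⟨g, rfl⟩ := hx; rw [(hγ g).1, f1, f1, (hγ g).2]
    by_cases hx' : ∃ g, e2 g = x
    · obtain ⟨g, rfl⟩ := hx'; rw [(hγ g).2, f2, f2, (hγ g).1]
    rw [f3 x hx hx', f3]
    · rintro ⟨g, hg⟩
      exact hx ⟨γ g, by rw [← (hγ g).1, hg, hbb]⟩
    · rintro ⟨g, hg⟩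
      exact hx' ⟨γ g, by rw [← (hγ g).2, hg, hbb]⟩

end Induced

section Aut
variable {α : Type}

/-- Label-preserving permutations. -/
def coxAut (m : α → α → ℕ∞) : Subgroup (Equiv.Perm α) where
  carrier := {g | ∀ a b, m (g a) (g b) = m a b}
  mul_mem' := by
    intro g h hg hh a b
    rw [Equiv.Perm.mul_apply, Equiv.Perm.mul_apply, hg, hh]
  one_mem' := fun _ _ => rfl
  inv_mem' := by
    intro g hg a b
    rw [← hg]
    simp

/-- A label-preserving action on the generators induces an action on the Coxeter group. -/
def coxAct (m : α → α → ℕ∞) {F : Type} [Group F] (ρ : F →* Equiv.Perm α)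
    (hρ : ∀ f a b, m (ρ f a) (ρ f b) = m a b) : F →* MulAut (CoxGroup m) where
  toFun f := MonoidHom.toMulEquiv
    (coxMap (m := m) (m' := m) (ρ f) (ρ f).injective (fun s t _ => hρ f s t))
    (coxMap (m := m) (m' := m) (ρ f⁻¹) (ρ f⁻¹).injective (fun s t _ => hρ f⁻¹ s t))
    (coxHom_ext fun s => by simp) (coxHom_ext fun s => by simp)
  map_one' := by
    refine MulEquiv.ext fun x => ?_
    exact DFunLike.congr_fun (coxHom_ext (f := coxMap (m := m) (m' := m) (ρ 1) (ρ 1).injective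
      (fun s t _ => hρ 1 s t)) (g := MonoidHom.id _) fun s => by simp) x
  map_mul' f g := by
    refine MulEquiv.ext fun x => ?_
    exact DFunLike.congr_fun (coxHom_ext (f := coxMap (m := m) (m' := m) (ρ (f * g))
      (ρ (f * g)).injective (fun s t _ => hρ (f * g) s t))
      (g := (coxMap (m := m) (m' := m) (ρ f) (ρ f).injective (fun s t _ => hρ f s t)).comp
        (coxMap (m := m) (m' := m) (ρ g) (ρ g).injective (fun s t _ => hρ g s t)))
        fun s => by simp) x

@[simp] theorem coxAct_of (m : α → α → ℕ∞) {F : Type} [Group F] (ρ : F →* Equiv.Perm α)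
    (hρ : ∀ f a b, m (ρ f a) (ρ f b) = m a b) (f : F) (s : α) :
    coxAct m ρ hρ f (coxOf m s) = coxOf m (ρ f s) :=
  coxMap_of (m := m) (m' := m) (ρ f) (ρ f).injective (fun s t _ => hρ f s t) s

end Aut

section Assembly
open Classical

/-- The labels of the doubled system. -/
noncomputable def sumLabel {β F : Type} [Group F] (m' : β → β → ℕ∞) (ρ : F →* Equiv.Perm β)
    (B : Set β) : β ⊕ F → β ⊕ F → ℕ∞
  | Sum.inl a, Sum.inl b => m' a b
  | Sum.inl a, Sum.inr f => if ρ f⁻¹ a ∈ B then 2 else ⊤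
  | Sum.inr f, Sum.inl a => if ρ f⁻¹ a ∈ B then 2 else ⊤
  | Sum.inr _, Sum.inr _ => ⊤

/-- The action on the generators of the doubled system. -/
def sumAct {β F : Type} [Group F] (ρ : F →* Equiv.Perm β) : F →* Equiv.Perm (β ⊕ F) where
  toFun f := Equiv.sumCongr (ρ f) (Equiv.mulLeft f)
  map_one' := by ext x; cases x <;> simp
  map_mul' f g := by ext x; cases x <;> simp [mul_assoc]

@[simp] theorem sumAct_inl {β F : Type} [Group F] (ρ : F →* Equiv.Perm β) (f : F) (a : β) :
    sumAct ρ f (Sum.inl a) = Sum.inl (ρ f a) := rfl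
@[simp] theorem sumAct_inr {β F : Type} [Group F] (ρ : F →* Equiv.Perm β) (f g : F) :
    sumAct ρ f (Sum.inr g) = Sum.inr (f * g) := rfl

theorem sumAct_label {β F : Type} [Group F] (m' : β → β → ℕ∞) (ρ : F →* Equiv.Perm β)
    (hρ : ∀ f a b, m' (ρ f a) (ρ f b) = m' a b)
    (B : Set β) (f : F) (x y : β ⊕ F) :
    sumLabel m' ρ B (sumAct ρ f x) (sumAct ρ f y) = sumLabel m' ρ B x y := by
  cases x <;> cases y <;> simp [sumLabel, hρ]

/-- The generators of the HNN extension. -/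
def hnnOf {S : Type} (m : S → S → ℕ∞) (S' : Set S) (φ : S → S) (x : S ⊕ Unit) :
    CoxHNN m S' φ := PresentedGroup.of (rels := coxHNNRels m S' φ) x

theorem hnn_conj {S : Type} (m : S → S → ℕ∞) (S' : Set S) (φ : S → S) (s : S) (hs : s ∈ S') :
    hnnOf m S' φ (Sum.inl s) * hnnOf m S' φ (Sum.inr ()) =
      hnnOf m S' φ (Sum.inr ()) * hnnOf m S' φ (Sum.inl (φ s)) := by
  have h : (hnnOf m S' φ (Sum.inr ()))⁻¹ * hnnOf m S' φ (Sum.inl s) * hnnOf m S' φ (Sum.inr ()) *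
      (hnnOf m S' φ (Sum.inl (φ s)))⁻¹ = 1 :=
    PresentedGroup.one_of_mem (rels := coxHNNRels m S' φ) (Or.inr (Or.inr ⟨s, hs, rfl⟩))
  have h' := mul_inv_eq_one.mp h
  rw [← h']; group

/-- The natural map from the Coxeter group to the HNN extension. -/
def hnnBase {S : Type} (m : S → S → ℕ∞) (S' : Set S) (φ : S → S) : CoxGroup m →* CoxHNN m S' φ :=
  coxLift (fun s => hnnOf m S' φ (Sum.inl s))
    (fun s => PresentedGroup.one_of_mem (rels := coxHNNRels m S' φ) (Or.inl ⟨s, rfl⟩))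
    (fun s t n hst h => PresentedGroup.one_of_mem (rels := coxHNNRels m S' φ)
      (Or.inr (Or.inl ⟨s, t, n, hst, h, rfl⟩)))

@[simp] theorem hnnBase_of {S : Type} (m : S → S → ℕ∞) (S' : Set S) (φ : S → S) (s : S) :
    hnnBase m S' φ (coxOf m s) = hnnOf m S' φ (Sum.inl s) := coxLift_of _ _ _ _

/-- Universal property of the HNN extension. -/
theorem hnn_lift {S : Type} (m : S → S → ℕ∞) (S' : Set S) (φ : S → S) {Q : Type} [Group Q]
    (x : S → Q) (τ : Q) (h1 : ∀ s, x s * x s = 1)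
    (h2 : ∀ (s t : S) (n : ℕ), s ≠ t → m s t = n → (x s * x t) ^ n = 1)
    (h3 : ∀ s ∈ S', x s * τ = τ * x (φ s)) :
    ∃ Φ : CoxHNN m S' φ →* Q, (∀ s, Φ (hnnOf m S' φ (Sum.inl s)) = x s) ∧
      Φ (hnnOf m S' φ (Sum.inr ())) = τ := by
  refine ⟨PresentedGroup.toGroup (rels := coxHNNRels m S' φ) (f := Sum.elim x fun _ => τ) ?_,
    fun s => PresentedGroup.toGroup.of _, PresentedGroup.toGroup.of _⟩
  rintro r (⟨s, rfl⟩ | ⟨s, t, n, hst, h, rfl⟩ | ⟨s, hs, rfl⟩)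
  · simpa using h1 s
  · simpa using h2 s t n hst h
  · have := h3 s hs
    simp only [map_mul, map_inv, FreeGroup.lift_apply_of, Sum.elim_inl, Sum.elim_inr]
    rw [mul_inv_eq_one, mul_assoc, this]; group

/-- Faithfulness can be tested on a generating set. -/
theorem hnn_act {S : Type} (m : S → S → ℕ∞) (S' : Set S) (φ : S → S) {X : Type}
    (a : CoxHNN m S' φ →* Equiv.Perm X) (e : CoxHNN m S' φ → X)
    (h : ∀ x g, a (hnnOf m S' φ x) (e g) = e (hnnOf m S' φ x * g)) (g g' : CoxHNN m S' φ) :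
    a g (e g') = e (g * g') := by
  have hg : g ∈ Subgroup.closure (Set.range (hnnOf m S' φ)) := by
    have : Subgroup.closure (Set.range (hnnOf m S' φ)) = ⊤ :=
      PresentedGroup.closure_range_of (coxHNNRels m S' φ)
    rw [this]; trivial
  induction hg using Subgroup.closure_induction generalizing g' with
  | mem x hx => obtain ⟨x, rfl⟩ := hx; exact h x g'
  | one => simp
  | mul x y _ _ hx hy => rw [map_mul, Equiv.Perm.mul_apply, hy, hx, mul_assoc]
  | inv x _ hx =>
    rw [map_inv, Equiv.Perm.inv_eq_iff_eq, hx, mul_inv_cancel_left]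

theorem hnn_embeds {S β F : Type} [Group F] (m : S → S → ℕ∞) (S' : Set S) (φ : S → S)
    (m' : β → β → ℕ∞) (i : S → β) (hi : Function.Injective i)
    (hm : ∀ s t, s ≠ t → m' (i s) (i t) = m s t)
    (hsymm : ∀ s t, m' s t = m' t s) (h2 : ∀ s t, s ≠ t → 2 ≤ m' s t)
    (ρ : F →* Equiv.Perm β) (hρ : ∀ f a b, m' (ρ f a) (ρ f b) = m' a b)
    (p : F) (hp : p ≠ 1) (hpi : ∀ s ∈ S', ρ p (i (φ s)) = i s) :
    ∃ Φ : CoxHNN m S' φ →* CoxGroup (sumLabel m' ρ (i '' (φ '' S')))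
      ⋊[coxAct _ (sumAct ρ) (sumAct_label m' ρ hρ _)] F, Function.Injective Φ := by
  let B := i '' (φ '' S')
  let mT := sumLabel m' ρ B
  let θT : F →* MulAut (CoxGroup mT) := coxAct _ (sumAct ρ) (sumAct_label m' ρ hρ _)
  let θ : F →* MulAut (CoxGroup m') := coxAct m' ρ hρ
  let j : CoxGroup m →* CoxGroup m' ⋊[θ] F := SemidirectProduct.inl.comp (coxMap i hi hm)
  have hj : Function.Injective j :=
    SemidirectProduct.inl_injective.comp (coxMap_injective i hi hm hsymm h2)
  have hjof : ∀ s, j (coxOf m s) = SemidirectProduct.inl (coxOf m' (i s)) := fun s => by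
    simp [j]
  obtain ⟨X, a, e, ha, hjk, hinj⟩ := exists_induced j (hnnBase m S' φ)
  set t := hnnOf m S' φ (Sum.inr ()) with ht
  have hconj : ∀ f v, a (SemidirectProduct.inr f) * a (SemidirectProduct.inl (coxOf m' v)) *
      (a (SemidirectProduct.inr f))⁻¹ = a (SemidirectProduct.inl (coxOf m' (ρ f v))) := by
    intro f v
    rw [← map_inv, ← map_mul, ← map_mul, ← map_inv, ← SemidirectProduct.inl_aut]
    simp [θ]
  have hsq : ∀ v, a (SemidirectProduct.inl (coxOf m' v)) *
      a (SemidirectProduct.inl (coxOf m' v)) = 1 := by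
    intro v
    rw [← map_mul, ← map_mul, coxOf_sq, map_one, map_one]
  obtain ⟨u, hu, hu1, hu2⟩ := exists_swapPerm (fun g => e 1 g)
    (fun g => e (SemidirectProduct.inr p)⁻¹ (t * g))
    (by
      intro g g' h
      obtain ⟨w, hw, hg⟩ := hinj _ _ _ _ h
      have : w = 1 := hj (by simpa using hw.symm)
      simpa [this] using hg)
    (by
      intro g g' h
      obtain ⟨w, hw, hg⟩ := hinj _ _ _ _ h
      have : w = 1 := hj (by simpa using hw.symm)
      simpa [this] using hg)
    (by
      intro g g' h
      obtain ⟨w, hw, hg⟩ := hinj _ _ _ _ h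
      have := congrArg SemidirectProduct.right hw
      simp [j] at this
      exact hp this)
  have hcomm : ∀ b ∈ B, Commute u (a (SemidirectProduct.inl (coxOf m' b))) := by
    rintro _ ⟨_, ⟨s, hs, rfl⟩, rfl⟩
    refine hu2 _ (hsq _) ⟨fun g => hnnOf m S' φ (Sum.inl (φ s)) * g, fun g => ⟨?_, ?_⟩⟩
    · simp only []
      rw [ha, mul_one, ← hjof, ← one_mul (j _), hjk, hnnBase_of]
    · simp only []
      have h1 : (SemidirectProduct.inl (coxOf m' (i (φ s))) * (SemidirectProduct.inr p)⁻¹ :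
          CoxGroup m' ⋊[θ] F) = (SemidirectProduct.inr p)⁻¹ * j (coxOf m s) := by
        rw [hjof, ← hpi s hs]
        have : coxOf m' (ρ p (i (φ s))) = θ p (coxOf m' (i (φ s))) := by simp [θ]
        rw [this, SemidirectProduct.inl_aut]
        simp [mul_assoc]
      rw [ha, h1, hjk, hnnBase_of, ← mul_assoc, hnn_conj m S' φ s hs, mul_assoc]
  let gen : β ⊕ F → Equiv.Perm X := Sum.elim (fun v => a (SemidirectProduct.inl (coxOf m' v)))
    (fun f => a (SemidirectProduct.inr f) * u * (a (SemidirectProduct.inr f))⁻¹)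
  have gsq : ∀ x, gen x * gen x = 1 := by
    rintro (v | f)
    · exact hsq v
    · simp only [gen, Sum.elim_inr]
      calc _ = a (SemidirectProduct.inr f) * (u * u) * (a (SemidirectProduct.inr f))⁻¹ := by group
        _ = 1 := by rw [hu]; group
  have gcomm : ∀ v f, ρ f⁻¹ v ∈ B → Commute (gen (Sum.inl v)) (gen (Sum.inr f)) := by
    intro v f h
    have h1 := (hcomm _ h).symm
    have h3 := h1.map (MulAut.conj (a (SemidirectProduct.inr f))).toMonoidHom
    simp only [MulEquiv.toMonoidHom_eq_coe, MonoidHom.coe_coe, MulAut.conj_apply, hconj] at h3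
    simpa [gen] using h3
  have grel : ∀ (x y : β ⊕ F) (n : ℕ), x ≠ y → mT x y = n → (gen x * gen y) ^ n = 1 := by
    have two : ∀ n : ℕ, (2 : ℕ∞) = n → n = 2 := fun n h => by exact_mod_cast h.symm
    rintro (v | f) (w | g) n hne hn
    · simp only [gen, Sum.elim_inl]
      rw [← map_mul, ← map_mul, ← map_pow, ← map_pow, coxOf_rel (m := m') (by simpa using hne) hn,
        map_one, map_one]
    · by_cases h : ρ g⁻¹ v ∈ B
      · simp only [mT, sumLabel, if_pos h] at hn
        rw [two n hn, (gcomm v g h).mul_pow, pow_two, pow_two, gsq, gsq, one_mul]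
      · simp only [mT, sumLabel, if_neg h] at hn
        exact absurd hn.symm (ENat.natCast_ne_top n)
    · by_cases h : ρ f⁻¹ w ∈ B
      · simp only [mT, sumLabel, if_pos h] at hn
        rw [two n hn, (gcomm w f h).symm.mul_pow, pow_two, pow_two, gsq, gsq, one_mul]
      · simp only [mT, sumLabel, if_neg h] at hn
        exact absurd hn.symm (ENat.natCast_ne_top n)
    · exact absurd hn.symm (ENat.natCast_ne_top n)
  let A : CoxGroup mT →* Equiv.Perm X := coxLift gen gsq grel
  have hA : ∀ x, A (coxOf mT x) = gen x := fun x => coxLift_of _ _ _ _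
  let Λ : CoxGroup mT ⋊[θT] F →* Equiv.Perm X :=
    SemidirectProduct.lift A (a.comp SemidirectProduct.inr) (by
      intro f
      refine coxHom_ext ?_
      rintro (v | g)
      · simp [θT, hA, gen, hconj]
      · simp [θT, hA, gen, mul_assoc])
  obtain ⟨Φ, hΦ1, hΦ2⟩ := hnn_lift m S' φ (Q := CoxGroup mT ⋊[θT] F)
    (fun s => SemidirectProduct.inl (coxOf mT (Sum.inl (i s))))
    (SemidirectProduct.inr p * SemidirectProduct.inl (coxOf mT (Sum.inr 1)))
    (fun s => by rw [← map_mul, coxOf_sq, map_one])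
    (fun s t n hst h => by
      rw [← map_mul, ← map_pow, coxOf_rel _ _, map_one]
      · simpa using hi.ne hst
      · exact (hm s t hst).trans h)
    (by
      intro s hs
      have h1 : (coxOf mT (Sum.inl (i s))) = θT p (coxOf mT (Sum.inl (i (φ s)))) := by
        simp [θT, hpi s hs]
      have hB : i (φ s) ∈ B := ⟨_, ⟨s, hs, rfl⟩, rfl⟩
      have h3 : (coxOf mT (Sum.inl (i (φ s))) * coxOf mT (Sum.inr 1)) ^ 2 = 1 :=
        coxOf_rel (by simp) (by simp [mT, sumLabel, hB])
      have h4 : coxOf mT (Sum.inl (i (φ s))) * coxOf mT (Sum.inr 1) =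
          coxOf mT (Sum.inr 1) * coxOf mT (Sum.inl (i (φ s))) := by
        rw [pow_two] at h3
        rw [eq_inv_of_mul_eq_one_left h3, mul_inv_rev, coxOf_inv, coxOf_inv]
      rw [h1, SemidirectProduct.inl_aut, mul_assoc (SemidirectProduct.inr p)
        (SemidirectProduct.inl _) (SemidirectProduct.inl _), ← map_mul, ← h4, map_mul]
      simp [mul_assoc])
  refine ⟨Φ, ?_⟩
  have key := hnn_act m S' φ (Λ.comp Φ) (fun g => e 1 g) (by
    rintro (s | ⟨⟩) g
    · simp only [MonoidHom.comp_apply, hΦ1, Λ, SemidirectProduct.lift_inl, hA, gen, Sum.elim_inl]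
      rw [ha, mul_one, ← hjof, ← one_mul (j _), hjk, hnnBase_of]
    · have := hu1 g
      simp only [MonoidHom.comp_apply, hΦ2, Λ, map_mul, SemidirectProduct.lift_inl,
        SemidirectProduct.lift_inr, hA, gen, Sum.elim_inr, map_one, one_mul, inv_one, mul_one,
        Equiv.Perm.mul_apply]
      rw [this, ha, mul_inv_cancel])
  rw [injective_iff_map_eq_one]
  intro g hg
  have h1 := key g 1
  simp only [MonoidHom.comp_apply, hg, map_one, Equiv.Perm.one_apply, mul_one] at h1
  obtain ⟨w, hw, hg'⟩ := hinj _ _ _ _ h1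
  have hw1 : w = 1 := hj (by simpa using hw.symm)
  rw [hw1, map_one, one_mul] at hg'
  exact hg'.symm

/-- A subgroup of a semidirect product with finite complement virtually lies in the kernel. -/
theorem virt_of_semidirect {G N F : Type} [Group G] [Group N] [Group F] [Finite F]
    (θ : F →* MulAut N) (Φ : G →* N ⋊[θ] F) (hΦ : Function.Injective Φ) :
    ∃ H : Subgroup G, H.index ≠ 0 ∧ ∃ ψ : H →* N, Function.Injective ψ := by
  have hr : ∀ h : (SemidirectProduct.rightHom.comp Φ).ker, (Φ h.1).right = 1 := fun h => h.2
  refine ⟨(SemidirectProduct.rightHom.comp Φ).ker, ?_,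
    { toFun := fun h => (Φ h.1).left
      map_one' := by simp
      map_mul' := fun x y => by simp [hr x] }, ?_⟩
  · rw [Subgroup.index_ker]
    exact Nat.card_pos.ne'
  · intro x y h
    exact Subtype.ext (hΦ (SemidirectProduct.ext h ((hr x).trans (hr y).symm)))

end Assembly

/-- Every Coxeter HNN-extension C(S, m, φ) contains a finite-index subgroup
that embeds into a Coxeter group whose set of labels is contained in L(S,m) ∪ {2, ∞}. -/
theorem coxeter_hnn_virtually_embeds
    (S : Type) [Fintype S]
    (m : S → S → ℕ∞)
    (hsymm : ∀ s t, m s t = m t s)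
    (h2 : ∀ s t, s ≠ t → 2 ≤ m s t)
    (S' S'' : Set S) (φ : S → S)
    (hmap : ∀ s ∈ S', φ s ∈ S'')
    (hinj : Set.InjOn φ S')
    (hsurj : S'' ⊆ φ '' S')
    (hpres : ∀ s ∈ S', ∀ t ∈ S', m s t = m (φ s) (φ t)) :
    ∃ (T : Type) (_ : Fintype T) (mT : T → T → ℕ∞),
      (∀ a b, mT a b = mT b a) ∧
      (∀ a b, a ≠ b → 2 ≤ mT a b) ∧
      -- the labels of (T, mT) lie in L(S,m) ∪ {2, ∞}
      (∀ a b, a ≠ b → mT a b = 2 ∨ mT a b = ⊤ ∨ ∃ s t : S, s ≠ t ∧ mT a b = m s t) ∧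
      ∃ H : Subgroup (CoxHNN m S' φ), H.index ≠ 0 ∧
        ∃ ψ : H →* CoxGroup mT, Function.Injective ψ := by
  classical
  obtain ⟨β, hβ, m', i, π, hi, hm, hs', h2', hl, hπ, hπi⟩ :=
    exists_extension S m hsymm h2 S' φ hinj hpres
  let F := coxAut m' × Multiplicative (ZMod 2)
  let ρ : F →* Equiv.Perm β := (coxAut m').subtype.comp (MonoidHom.fst _ _)
  have hρ : ∀ f a b, m' (ρ f a) (ρ f b) = m' a b := fun f a b => f.1.2 a b
  let p : F := ((⟨π, hπ⟩ : coxAut m')⁻¹, Multiplicative.ofAdd 1)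
  have hp : p ≠ 1 := by
    intro h
    have h1 : (1 : ZMod 2) = 0 := congrArg (fun x : F => Multiplicative.toAdd x.2) h
    exact absurd h1 (by decide)
  have hpi : ∀ s ∈ S', ρ p (i (φ s)) = i s := by
    intro s hs
    change π⁻¹ (i (φ s)) = i s
    rw [← hπi s hs]
    simp
  obtain ⟨Φ, hΦ⟩ := hnn_embeds m S' φ m' i hi hm hs' h2' ρ hρ p hp hpi
  haveI : Finite F := inferInstanceAs (Finite (coxAut m' × ZMod 2))
  refine ⟨β ⊕ F, Fintype.ofFinite _, sumLabel m' ρ (i '' (φ '' S')), ?_, ?_, ?_,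
    virt_of_semidirect _ Φ hΦ⟩
  · rintro (a | f) (b | g)
    · exact hs' a b
    · rfl
    · rfl
    · rfl
  · rintro (a | f) (b | g) hab
    · exact h2' a b (by simpa using hab)
    · simp only [sumLabel]; split_ifs <;> simp
    · simp only [sumLabel]; split_ifs <;> simp
    · simp [sumLabel]
  · rintro (a | f) (b | g) hab
    · exact Or.inr (hl a b)
    · simp only [sumLabel]; split_ifs <;> simp
    · simp only [sumLabel]; split_ifs <;> simp
    · simp [sumLabel]
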